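/- Fix p ∈ (0,1), α with 0 < α < 1/(1+p), and a grading exponent q > 4/α. For each n ≥ 1 let π_h be the piecewise-constant mean-value projection on the graded mesh with nodes t_i = (i/n)^q. Then there is a constant C, independent of n and u, such that for every u ∈ C⁴_α, sup_{x ∈ (0,1]} |((I − π_h)K(I − π_h)u)(x)| ≤ C·n^{−3}·‖u‖_{4,α}. -/

import Mathlib

open MeasureTheory Real

/-- The double-layer corner kernel
`k(x,y) = (sin(pπ)/π)·x/(x² + y² + 2xy·cos(pπ))` for a corner of interior angle
`(1−p)π`. -/
noncomputable def cornerKernel (p x y : ℝ) : ℝ :=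
  Real.sin (p * Real.pi) / Real.pi * x / (x ^ 2 + y ^ 2 + 2 * x * y * Real.cos (p * Real.pi))

/-- The corner operator `(Ku)(x) = ∫₀¹ k(x,y)·u(y) dy`. -/
noncomputable def cornerOp (p : ℝ) (u : ℝ → ℝ) (x : ℝ) : ℝ :=
  ∫ y in Set.Ioc (0 : ℝ) 1, cornerKernel p x y * u y

/-- Node `t_i = (i/n)^q` of the graded mesh on `[0,1]` with grading exponent `q`. -/
noncomputable def gradedNode (n : ℕ) (q : ℝ) (i : ℕ) : ℝ :=
  ((i : ℝ) / (n : ℝ)) ^ q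

/-- The piecewise-constant mean-value (Galerkin) projection `π_h` on the graded mesh:
on each subinterval `τ_i = (t_{i−1}, t_i]` the function is replaced by its mean value. -/
noncomputable def gradedProj (n : ℕ) (q : ℝ) (u : ℝ → ℝ) (x : ℝ) : ℝ :=
  ∑ i ∈ Finset.Icc 1 n,
    Set.indicator (Set.Ioc (gradedNode n q (i - 1)) (gradedNode n q i))
      (fun _ => (gradedNode n q i - gradedNode n q (i - 1))⁻¹ *
        ∫ y in Set.Ioc (gradedNode n q (i - 1)) (gradedNode n q i), u y) x

/-- The set of weighted values whose supremum is the weighted norm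
`‖u‖_{m,α} = max_{0≤i≤m} sup_{t∈(0,1]} t^{max(i−α,0)}·|u^{(i)}(t)|`, with derivatives
taken within `(0,1]`. -/
def weightedSet (m : ℕ) (α : ℝ) (u : ℝ → ℝ) : Set ℝ :=
  {r : ℝ | ∃ i ≤ m, ∃ t ∈ Set.Ioc (0 : ℝ) 1,
    r = t ^ max ((i : ℝ) - α) 0 * |iteratedDerivWithin i u (Set.Ioc 0 1) t|}

/-- The weighted norm `‖u‖_{m,α}`. -/
noncomputable def weightedNorm (m : ℕ) (α : ℝ) (u : ℝ → ℝ) : ℝ :=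
  sSup (weightedSet m α u)

/-- `K(I − π_h)u`, the corner operator applied to the projection error of `u`. -/
noncomputable def cornerErr (p q : ℝ) (n : ℕ) (u : ℝ → ℝ) : ℝ → ℝ :=
  fun x => cornerOp p (fun y => u y - gradedProj n q u y) x

theorem ce_Q_lower {c x y : ℝ} (hc1 : c ≤ 1) :
    (1 + c) / 2 * (x + y) ^ 2 ≤ x ^ 2 + y ^ 2 + 2 * x * y * c := by
  nlinarith [mul_nonneg (sub_nonneg.2 hc1) (sq_nonneg (x - y))]

theorem ce_deriv_y {c x y : ℝ} (hQ : x ^ 2 + y ^ 2 + 2 * x * y * c ≠ 0) :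
    HasDerivAt (fun y => x / (x ^ 2 + y ^ 2 + 2 * x * y * c))
      (-(x * (2 * y + 2 * x * c)) / (x ^ 2 + y ^ 2 + 2 * x * y * c) ^ 2) y := by
  have h1 : HasDerivAt (fun y : ℝ => x ^ 2 + y ^ 2 + 2 * x * y * c) (2 * y + 2 * x * c) y := by
    have := (((hasDerivAt_id y).pow 2).const_add (x ^ 2)).add
      (((hasDerivAt_id y).const_mul (2 * x)).mul_const c)
    refine this.congr_deriv ?_
    simp
  have := (hasDerivAt_const y x).div h1 hQ
  refine this.congr_deriv ?_
  ring

theorem ce_deriv_x {c x y : ℝ} (hQ : x ^ 2 + y ^ 2 + 2 * x * y * c ≠ 0) :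
    HasDerivAt (fun x => -(x * (2 * y + 2 * x * c)) / (x ^ 2 + y ^ 2 + 2 * x * y * c) ^ 2)
      (-(2 * y + 4 * x * c) / (x ^ 2 + y ^ 2 + 2 * x * y * c) ^ 2 +
        2 * x * (2 * y + 2 * x * c) * (2 * x + 2 * y * c) /
          (x ^ 2 + y ^ 2 + 2 * x * y * c) ^ 3) x := by
  have h1 : HasDerivAt (fun x : ℝ => x ^ 2 + y ^ 2 + 2 * x * y * c) (2 * x + 2 * y * c) x := by
    have := (((hasDerivAt_id x).pow 2).add_const (y ^ 2)).add
      ((((hasDerivAt_id x).const_mul 2).mul_const y).mul_const c)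
    refine this.congr_deriv ?_
    simp
  have h2 : HasDerivAt (fun x : ℝ => -(x * (2 * y + 2 * x * c))) (-(2 * y + 4 * x * c)) x := by
    have := ((hasDerivAt_id x).mul
      ((((hasDerivAt_id x).const_mul 2).mul_const c).const_add (2 * y))).neg
    refine this.congr_deriv ?_
    simp; ring
  have := h2.div (h1.pow 2) (pow_ne_zero 2 hQ)
  refine this.congr_deriv ?_
  simp only [Pi.pow_apply]
  generalize x ^ 2 + y ^ 2 + 2 * x * y * c = Q at *
  field_simp
  push_cast
  ring

theorem ce_second_bound {c x y m : ℝ} (hc0 : -1 < c) (hc1 : c ≤ 1) (hx : 0 ≤ x) (hy : 0 ≤ y)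
    (hm : 0 < m) (hmx : m ≤ x + y) :
    |(-(2 * y + 4 * x * c) / (x ^ 2 + y ^ 2 + 2 * x * y * c) ^ 2 +
        2 * x * (2 * y + 2 * x * c) * (2 * x + 2 * y * c) /
          (x ^ 2 + y ^ 2 + 2 * x * y * c) ^ 3)| ≤
      (4 / ((1 + c) / 2) ^ 2 + 8 / ((1 + c) / 2) ^ 3) / m ^ 3 := by
  have hQ := ce_Q_lower (x := x) (y := y) hc1
  set Q := x ^ 2 + y ^ 2 + 2 * x * y * c
  set l := (1 + c) / 2 with hl
  have hl0 : 0 < l := by rw [hl]; linarith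
  have hs : 0 < x + y := lt_of_lt_of_le hm hmx
  set s := x + y with hsdef
  have hls : 0 < l * s ^ 2 := by positivity
  have hQ0 : 0 < Q := lt_of_lt_of_le hls hQ
  have hcx : |x * c| ≤ x := by
    rw [abs_le]; constructor <;> nlinarith
  have hcy : |y * c| ≤ y := by
    rw [abs_le]; constructor <;> nlinarith
  rw [abs_le] at hcx hcy
  have e1 : |-(2 * y + 4 * x * c)| ≤ 4 * s := by
    rw [abs_le]; constructor <;> nlinarith
  have e2 : |2 * y + 2 * x * c| ≤ 2 * s := by
    rw [abs_le]; constructor <;> nlinarith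
  have e3 : |2 * x + 2 * y * c| ≤ 2 * s := by
    rw [abs_le]; constructor <;> nlinarith
  have e4 : |2 * x| ≤ 2 * s := by
    rw [abs_le]; constructor <;> nlinarith
  have t1 : |-(2 * y + 4 * x * c) / Q ^ 2| ≤ 4 * s / (l * s ^ 2) ^ 2 := by
    rw [abs_div, abs_of_pos (pow_pos hQ0 2)]
    gcongr
  have t2 : |2 * x * (2 * y + 2 * x * c) * (2 * x + 2 * y * c) / Q ^ 3| ≤
      (2 * s) * (2 * s) * (2 * s) / (l * s ^ 2) ^ 3 := by
    rw [abs_div, abs_of_pos (pow_pos hQ0 3), abs_mul, abs_mul]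
    gcongr
  calc _ ≤ _ := abs_add_le _ _
    _ ≤ _ := add_le_add t1 t2
    _ = (4 / l ^ 2 + 8 / l ^ 3) / s ^ 3 := by field_simp; ring
    _ ≤ _ := by gcongr

theorem ce_mixed {c : ℝ} (hc0 : -1 < c) (hc1 : c ≤ 1) {a b x x' y y' : ℝ} (ha : 0 ≤ a)
    (hb : 0 < b) (hx : a ≤ x) (hx' : a ≤ x') (hy : b ≤ y) (hy' : b ≤ y') :
    |(x / (x ^ 2 + y ^ 2 + 2 * x * y * c) - x' / (x' ^ 2 + y ^ 2 + 2 * x' * y * c)) -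
      (x / (x ^ 2 + y' ^ 2 + 2 * x * y' * c) - x' / (x' ^ 2 + y' ^ 2 + 2 * x' * y' * c))| ≤
      (4 / ((1 + c) / 2) ^ 2 + 8 / ((1 + c) / 2) ^ 3) / (a + b) ^ 3 * |x - x'| * |y - y'| := by
  set K := (4 / ((1 + c) / 2) ^ 2 + 8 / ((1 + c) / 2) ^ 3) / (a + b) ^ 3 with hK
  have hne : ∀ x y : ℝ, a ≤ x → b ≤ y → x ^ 2 + y ^ 2 + 2 * x * y * c ≠ 0 := by
    intro x y hx hy
    have := ce_Q_lower (c := c) (x := x) (y := y) hc1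
    have h2 : 0 < (1 + c) / 2 * (x + y) ^ 2 := by
      have : 0 < x + y := by linarith
      have : 0 < 1 + c := by linarith
      positivity
    linarith
  have key : ∀ y, b ≤ y →
      ‖-(x * (2 * y + 2 * x * c)) / (x ^ 2 + y ^ 2 + 2 * x * y * c) ^ 2 -
        -(x' * (2 * y + 2 * x' * c)) / (x' ^ 2 + y ^ 2 + 2 * x' * y * c) ^ 2‖ ≤ K * ‖x - x'‖ := by
    intro y hy
    exact (convex_Ici a).norm_image_sub_le_of_norm_hasDerivWithin_le
      (f := fun x => -(x * (2 * y + 2 * x * c)) / (x ^ 2 + y ^ 2 + 2 * x * y * c) ^ 2)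
      (fun z hz => (ce_deriv_x (hne z y hz hy)).hasDerivWithinAt)
      (fun z hz => ce_second_bound hc0 hc1 (ha.trans hz) (hb.le.trans hy) (by linarith)
        (by have : a ≤ z := hz
            linarith)) hx' hx
  exact (convex_Ici b).norm_image_sub_le_of_norm_hasDerivWithin_le
      (f := fun y => x / (x ^ 2 + y ^ 2 + 2 * x * y * c) - x' / (x' ^ 2 + y ^ 2 + 2 * x' * y * c))
      (fun z hz => ((ce_deriv_y (hne x z hx hz)).sub (ce_deriv_y (hne x' z hx' hz))).hasDerivWithinAt)
      (fun z hz => key z hz) hy' hy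

theorem ce_int_sq {x T : ℝ} (hx : 0 < x) (hT : 0 ≤ T) :
    ∫ y in (0:ℝ)..T, x / (x + y) ^ 2 ≤ 1 := by
  have hpos : ∀ y ∈ Set.uIcc 0 T, 0 < x + y := by
    intro y hy
    rw [Set.uIcc_of_le hT] at hy
    linarith [hy.1]
  have h : ∀ y ∈ Set.uIcc 0 T, HasDerivAt (fun y => -x / (x + y)) (x / (x + y) ^ 2) y := by
    intro y hy
    have := (hasDerivAt_const y (-x)).div ((hasDerivAt_id y).const_add x) (hpos y hy).ne'
    refine this.congr_deriv ?_
    simp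
  rw [intervalIntegral.integral_eq_sub_of_hasDerivAt h]
  · have h1 : 0 ≤ x / (x + T) := by positivity
    have h2 : x / (x + 0) = 1 := by rw [add_zero]; exact div_self hx.ne'
    rw [neg_div, neg_div, h2]; linarith
  · apply ContinuousOn.intervalIntegrable
    intro y hy
    have := hpos y hy
    apply ContinuousAt.continuousWithinAt
    have h3 : (x + y) ^ 2 ≠ 0 := by positivity
    fun_prop (disch := assumption)

/-- power difference -/
theorem ce_pow_diff {r : ℝ} (hr : 1 ≤ r) (n : ℕ) (hn : 1 ≤ n) (j : ℕ) :
    (((j + 1 : ℕ) : ℝ) / n) ^ r - ((j : ℝ) / n) ^ r ≤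
      r * (((j + 1 : ℕ) : ℝ) / n) ^ (r - 1) / n := by
  have hn0 : (0 : ℝ) < n := by exact_mod_cast hn
  set J : ℝ := ((j + 1 : ℕ) : ℝ) with hJ
  have hJ0 : 0 < J := by rw [hJ]; positivity
  have hJ1 : 1 ≤ J := by rw [hJ]; push_cast; linarith [Nat.cast_nonneg (α := ℝ) j]
  have hj : (j : ℝ) = J - 1 := by rw [hJ]; push_cast; ring
  have hinv : J⁻¹ ≤ 1 := inv_le_one_of_one_le₀ hJ1
  have hb := one_add_mul_self_le_rpow_one_add (s := -J⁻¹) (by linarith) hr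
  have hfac : (j : ℝ) / n = J / n * (1 + -J⁻¹) := by
    rw [hj]; field_simp; ring
  rw [hfac, Real.mul_rpow (by positivity) (by linarith), Real.rpow_sub_one (by positivity)]
  have hp : 0 < (J / n) ^ r := by positivity
  have : r * ((J / n) ^ r / (J / n)) / n = r * (J / n) ^ r * J⁻¹ := by field_simp
  rw [this]
  nlinarith

theorem ce_mean {f : ℝ → ℝ} {a b B z : ℝ} (hab : a < b)
    (hf : IntegrableOn f (Set.Ioc a b)) (h : ∀ y ∈ Set.Ioc a b, |f z - f y| ≤ B) :
    |f z - (b - a)⁻¹ * ∫ y in Set.Ioc a b, f y| ≤ B := by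
  have hba : 0 < b - a := sub_pos.2 hab
  have e : f z - (b - a)⁻¹ * ∫ y in Set.Ioc a b, f y
      = (b - a)⁻¹ * ∫ y in Set.Ioc a b, (f z - f y) := by
    rw [integral_sub (by simp) hf]
    simp [hab.le]
    field_simp
  rw [e, abs_mul, abs_of_pos (inv_pos.2 hba)]
  have := norm_setIntegral_le_of_norm_le_const (μ := volume) (s := Set.Ioc a b)
    (f := fun y => f z - f y) (C := B) (by simp) h
  rw [Real.norm_eq_abs] at this
  simp [hab.le] at this
  rw [inv_mul_le_iff₀ hba]
  linarith

theorem ce_osc {α N : ℝ} {u : ℝ → ℝ} (hα : 0 < α)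
    (hu : DifferentiableOn ℝ u (Set.Ioc 0 1))
    (hd : ∀ t ∈ Set.Ioc (0:ℝ) 1, |derivWithin u (Set.Ioc 0 1) t| ≤ N * t ^ (α - 1))
    {a b : ℝ} (ha : 0 < a) (hab : a ≤ b) (hb : b ≤ 1) :
    |u b - u a| ≤ N / α * (b ^ α - a ^ α) := by
  have hsub : Set.Icc a b ⊆ Set.Ioc 0 1 := fun t ht => ⟨ha.trans_le ht.1, ht.2.trans hb⟩
  have := image_norm_le_of_norm_deriv_right_le_deriv_boundary'
    (f := fun t => u t - u a) (f' := fun t => derivWithin u (Set.Ioc 0 1) t) (a := a) (b := b)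
    (B := fun t => N / α * (t ^ α - a ^ α)) (B' := fun t => N * t ^ (α - 1))
    ((hu.continuousOn.mono hsub).sub continuousOn_const) ?_ (by simp) ?_ ?_ ?_
    (Set.right_mem_Icc.2 hab)
  · exact this
  · intro t ht
    have ht0 : 0 < t := ha.trans_le ht.1
    have ht1 : t < 1 := ht.2.trans_le hb
    have := (hu t ⟨ht0, ht1.le⟩).hasDerivWithinAt.hasDerivAt (Ioc_mem_nhds ht0 ht1)
    exact (this.sub_const _).hasDerivWithinAt
  · intro t ht
    have ht0 : 0 < t := ha.trans_le ht.1
    apply ContinuousAt.continuousWithinAt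
    exact ((Real.continuousAt_rpow_const t α (Or.inl ht0.ne')).sub continuousAt_const).const_mul _
  · intro t ht
    have ht0 : 0 < t := ha.trans_le ht.1
    have := ((Real.hasDerivAt_rpow_const (x := t) (p := α) (Or.inl ht0.ne')).sub_const
      (a ^ α)).const_mul (N / α)
    refine (this.congr_deriv ?_).hasDerivWithinAt
    field_simp
  · intro t ht
    exact hd t (hsub ⟨ht.1, ht.2.le⟩)

noncomputable def ceK (c x y : ℝ) : ℝ := x / (x ^ 2 + y ^ 2 + 2 * x * y * c)

theorem ceK_contOn {c x : ℝ} (hc0 : -1 < c) (hc1 : c ≤ 1) (hx : 0 < x) (a b : ℝ) (ha : 0 ≤ a)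
    (hb : 0 ≤ b) : ContinuousOn (ceK c x) (Set.uIcc a b) := by
  intro y hy
  have hy0 : 0 ≤ y := (le_min ha hb).trans hy.1
  have := ce_Q_lower (c := c) (x := x) (y := y) hc1
  have h2 : 0 < (1 + c) / 2 * (x + y) ^ 2 := by
    have : 0 < x + y := by linarith
    have : 0 < 1 + c := by linarith
    positivity
  have h3 : x ^ 2 + y ^ 2 + 2 * x * y * c ≠ 0 := by linarith
  exact (ce_deriv_y h3).continuousAt.continuousWithinAt

theorem ceK_abs {c x y : ℝ} (hc0 : -1 < c) (hc1 : c ≤ 1) (hx : 0 < x) (hy : 0 ≤ y) :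
    |ceK c x y| ≤ ((1 + c) / 2)⁻¹ * (x / (x + y) ^ 2) := by
  have := ce_Q_lower (c := c) (x := x) (y := y) hc1
  have hs : 0 < x + y := by linarith
  have hc : 0 < 1 + c := by linarith
  have h2 : 0 < (1 + c) / 2 * (x + y) ^ 2 := by positivity
  have hQ := h2.trans_le this
  unfold ceK
  rw [abs_div, abs_of_pos hx, abs_of_pos hQ]
  calc _ ≤ x / ((1 + c) / 2 * (x + y) ^ 2) := by gcongr
    _ = _ := by field_simp

theorem ceK_first {c x T G : ℝ} {g : ℝ → ℝ} (hc0 : -1 < c) (hc1 : c ≤ 1) (hx : 0 < x)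
    (hT : 0 ≤ T) (hG : 0 ≤ G) (hg : ∀ y ∈ Set.Ioc 0 T, |g y| ≤ G) :
    |∫ y in (0:ℝ)..T, ceK c x y * g y| ≤ ((1 + c) / 2)⁻¹ * G := by
  have hc : 0 < 1 + c := by linarith
  have h : ‖∫ y in (0:ℝ)..T, ceK c x y * g y‖ ≤
      ∫ y in (0:ℝ)..T, ((1 + c) / 2)⁻¹ * G * (x / (x + y) ^ 2) := by
    apply intervalIntegral.norm_integral_le_of_norm_le hT
    · filter_upwards with y hy
      rw [norm_mul]
      have h1 := ceK_abs hc0 hc1 hx hy.1.le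
      have h2 := hg y hy
      have h3 : 0 ≤ x / (x + y) ^ 2 := by positivity
      calc _ ≤ (((1 + c) / 2)⁻¹ * (x / (x + y) ^ 2)) * G := by
            apply mul_le_mul h1 h2 (abs_nonneg _); positivity
        _ = _ := by ring
    · apply ContinuousOn.intervalIntegrable
      intro y hy
      rw [Set.uIcc_of_le hT] at hy
      have : 0 < x + y := by linarith [hy.1]
      apply ContinuousAt.continuousWithinAt
      have h3 : (x + y) ^ 2 ≠ 0 := by positivity
      fun_prop (disch := assumption)
  rw [intervalIntegral.integral_const_mul] at h
  refine h.trans ?_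
  have h4 : 0 ≤ ((1 + c) / 2)⁻¹ * G := by positivity
  nlinarith [ce_int_sq hx hT]

theorem ce_node_zero {n : ℕ} {q : ℝ} (hq : 0 < q) : gradedNode n q 0 = 0 := by
  simp [gradedNode, Real.zero_rpow hq.ne']

theorem ce_node_n {n : ℕ} {q : ℝ} (hn : 1 ≤ n) : gradedNode n q n = 1 := by
  have : (n : ℝ) ≠ 0 := by positivity
  simp [gradedNode, this]

theorem ce_node_mono {n : ℕ} {q : ℝ} (hn : 1 ≤ n) (hq : 0 < q) : StrictMono (gradedNode n q) := by
  intro i j hij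
  have : (0 : ℝ) < n := by positivity
  have : (i : ℝ) < j := by exact_mod_cast hij
  unfold gradedNode
  gcongr

theorem ce_node_nonneg (n : ℕ) (q : ℝ) (i : ℕ) : 0 ≤ gradedNode n q i := by
  unfold gradedNode; positivity

theorem ce_proj_eq {n : ℕ} {q : ℝ} (hn : 1 ≤ n) (hq : 0 < q) (u : ℝ → ℝ) {j : ℕ} (hj : j < n)
    {y : ℝ} (hy : y ∈ Set.Ioc (gradedNode n q j) (gradedNode n q (j + 1))) :
    gradedProj n q u y = (gradedNode n q (j + 1) - gradedNode n q j)⁻¹ *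
        ∫ y in Set.Ioc (gradedNode n q j) (gradedNode n q (j + 1)), u y := by
  unfold gradedProj
  rw [Finset.sum_eq_single (j + 1)]
  · simp only [Nat.add_sub_cancel]
    rw [Set.indicator_of_mem hy]
  · intro i hi hne
    apply Set.indicator_of_notMem
    intro hy2
    have hm := ce_node_mono hn hq
    have h1 := hm.lt_iff_lt.1 (hy.1.trans_le hy2.2)
    have h2 := hm.lt_iff_lt.1 (hy2.1.trans_le hy.2)
    simp at hi
    omega
  · intro h; simp at h; omega

theorem ce_exists_cell {n : ℕ} {q : ℝ} (hn : 1 ≤ n) (hq : 0 < q) {x : ℝ}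
    (hx : x ∈ Set.Ioc (0:ℝ) 1) :
    ∃ i < n, x ∈ Set.Ioc (gradedNode n q i) (gradedNode n q (i + 1)) := by
  classical
  have hex : ∃ k, x ≤ gradedNode n q k := ⟨n, by rw [ce_node_n hn]; exact hx.2⟩
  have h1 := Nat.find_spec hex
  have h2 : Nat.find hex ≤ n := Nat.find_min' hex (by rw [ce_node_n hn]; exact hx.2)
  have h0 : Nat.find hex ≠ 0 := by
    intro h
    rw [h, ce_node_zero hq] at h1
    linarith [hx.1]
  obtain ⟨i, hi⟩ := Nat.exists_eq_succ_of_ne_zero h0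
  have h3 := Nat.find_min hex (m := i) (by omega)
  rw [hi] at h1
  exact ⟨i, by omega, not_le.1 h3, h1⟩

theorem ce_term {n i j : ℕ} {q N K : ℝ} (hn : 1 ≤ n) (hq : 1 ≤ q) (hN : 0 ≤ N) (hK : 0 ≤ K)
    (hi : i < n) (hj : j < n) (hj1 : 1 ≤ j) :
    (K / (gradedNode n q i + gradedNode n q j) ^ 3 * (gradedNode n q (i + 1) - gradedNode n q i) *
      (gradedNode n q (j + 1) - gradedNode n q j)) * (N * q * (((j + 1 : ℕ) : ℝ) / n) ^ 3 / n) *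
      (gradedNode n q (j + 1) - gradedNode n q j) ≤ K * q ^ 4 * (2 ^ q) ^ 3 * N / n ^ 4 := by
  have hn0 : (0 : ℝ) < n := by positivity
  have hm := ce_node_mono hn (by linarith : 0 < q)
  set M : ℕ := max (i + 1) (j + 1) with hM
  have hM0 : (0 : ℝ) < M := by positivity
  set ρ : ℝ := (M : ℝ) / n with hρ
  have hρ0 : 0 < ρ := by positivity
  have hdiff : ∀ l, l + 1 ≤ M → gradedNode n q (l + 1) - gradedNode n q l ≤ q * ρ ^ (q - 1) / n := by
    intro l hl
    refine (ce_pow_diff hq n hn l).trans ?_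
    have hl' : ((l + 1 : ℕ) : ℝ) ≤ M := by exact_mod_cast hl
    have : (((l + 1 : ℕ) : ℝ) / n) ^ (q - 1) ≤ ρ ^ (q - 1) := by
      apply Real.rpow_le_rpow (by positivity) _ (by linarith)
      rw [hρ]; gcongr
    gcongr
  have hi1 := hdiff i (le_max_left _ _)
  have hj2 := hdiff j (le_max_right _ _)
  have hi0 : 0 ≤ gradedNode n q (i + 1) - gradedNode n q i := sub_nonneg.2 (hm.monotone (by omega))
  have hj0 : 0 ≤ gradedNode n q (j + 1) - gradedNode n q j := sub_nonneg.2 (hm.monotone (by omega))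
  have hJ : ((j + 1 : ℕ) : ℝ) / n ≤ ρ := by
    have : ((j + 1 : ℕ) : ℝ) ≤ M := by exact_mod_cast le_max_right _ _
    rw [hρ]; gcongr
  have hden : ρ ^ q / 2 ^ q ≤ gradedNode n q i + gradedNode n q j := by
    rw [← Real.div_rpow hρ0.le (by norm_num)]
    have haux : ∀ l : ℕ, M ≤ 2 * l → (ρ / 2) ^ q ≤ gradedNode n q l := by
      intro l hl
      have : (M : ℝ) ≤ 2 * l := by exact_mod_cast hl
      unfold gradedNode
      apply Real.rpow_le_rpow (by positivity) _ (by linarith)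
      rw [hρ, div_div, div_le_div_iff₀ (by positivity) hn0]
      nlinarith
    have h1 := ce_node_nonneg n q i
    have h2 := ce_node_nonneg n q j
    rcases le_total i j with h | h
    · have := haux j (by omega)
      linarith
    · have := haux i (by omega)
      linarith
  have hR : ρ ^ q = ρ ^ (q - 1) * ρ := by
    rw [← Real.rpow_add_one hρ0.ne']; ring_nf
  have hden0 : 0 < ρ ^ q / 2 ^ q := by positivity
  have hq0 : 0 < q := by linarith
  have hR0 : 0 < ρ ^ (q - 1) := by positivity
  calc _ ≤ (K / (ρ ^ q / 2 ^ q) ^ 3 * (q * ρ ^ (q - 1) / n) * (q * ρ ^ (q - 1) / n)) *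
        (N * q * ρ ^ 3 / n) * (q * ρ ^ (q - 1) / n) := by
        gcongr
    _ = _ := by
        rw [hR]
        field_simp

theorem ce_diff {n i : ℕ} {c q N : ℝ} {g : ℝ → ℝ} (hc0 : -1 < c) (hc1 : c ≤ 1)
    (hn : 1 ≤ n) (hq : 1 ≤ q) (hN : 0 ≤ N) (hi : i < n)
    (hgi : IntegrableOn g (Set.Ioc 0 1))
    (hg0 : ∀ j < n, ∫ y in (gradedNode n q j)..(gradedNode n q (j + 1)), g y = 0)
    (hgb : ∀ j < n, ∀ y ∈ Set.Ioc (gradedNode n q j) (gradedNode n q (j + 1)),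
      |g y| ≤ N * q * (((j + 1 : ℕ) : ℝ) / n) ^ 3 / n)
    {x x' : ℝ} (hx : x ∈ Set.Ioc (gradedNode n q i) (gradedNode n q (i + 1)))
    (hx' : x' ∈ Set.Ioc (gradedNode n q i) (gradedNode n q (i + 1))) :
    |(∫ y in (0:ℝ)..1, ceK c x y * g y) - ∫ y in (0:ℝ)..1, ceK c x' y * g y| ≤
      (2 * ((1 + c) / 2)⁻¹ * q + 
        (4 / ((1 + c) / 2) ^ 2 + 8 / ((1 + c) / 2) ^ 3) * q ^ 4 * (2 ^ q) ^ 3) *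
        ((n : ℝ) ^ 3)⁻¹ * N := by
  have hn0 : (0 : ℝ) < n := by positivity
  have hn1 : (1 : ℝ) ≤ n := by exact_mod_cast hn
  have hc : 0 < 1 + c := by linarith
  have hq0 : 0 < q := by linarith
  have hm := ce_node_mono hn hq0
  have hx0 : 0 < x := (ce_node_nonneg n q i).trans_lt hx.1
  have hx0' : 0 < x' := (ce_node_nonneg n q i).trans_lt hx'.1
  have hz := ce_node_zero (n := n) hq0
  have ho := ce_node_n (q := q) hn
  have hgI : ∀ j < n, IntervalIntegrable g volume (gradedNode n q j) (gradedNode n q (j + 1)) := by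
    intro j hj
    rw [intervalIntegrable_iff_integrableOn_Ioc_of_le (hm.monotone (by omega))]
    apply hgi.mono_set
    apply Set.Ioc_subset_Ioc
    · exact ce_node_nonneg n q j
    · rw [← ho]; exact hm.monotone (by omega)
  have hkI : ∀ z, 0 < z → ∀ j < n, IntervalIntegrable (fun y => ceK c z y * g y) volume
      (gradedNode n q j) (gradedNode n q (j + 1)) := by
    intro z hz j hj
    exact (hgI j hj).continuousOn_mul (ceK_contOn hc0 hc1 hz _ _ (ce_node_nonneg _ _ _)
      (ce_node_nonneg _ _ _))
  have hsum : ∀ z, 0 < z → ∫ y in (0:ℝ)..1, ceK c z y * g y =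
      ∑ j ∈ Finset.range n, ∫ y in (gradedNode n q j)..(gradedNode n q (j + 1)),
        ceK c z y * g y := by
    intro z hz0
    rw [intervalIntegral.sum_integral_adjacent_intervals (hkI z hz0), hz, ho]
  rw [hsum x hx0, hsum x' hx0', ← Finset.sum_sub_distrib]
  set L := ((1 + c) / 2)⁻¹ with hL
  set K := 4 / ((1 + c) / 2) ^ 2 + 8 / ((1 + c) / 2) ^ 3 with hK
  have hL0 : 0 < L := by positivity
  have hK0 : 0 < K := by positivity
  have hterm : ∀ j ∈ Finset.range n,
      |(∫ y in (gradedNode n q j)..(gradedNode n q (j + 1)), ceK c x y * g y) -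
        ∫ y in (gradedNode n q j)..(gradedNode n q (j + 1)), ceK c x' y * g y| ≤
      (2 * L * q + K * q ^ 4 * (2 ^ q) ^ 3) * N / n ^ 4 := by
    intro j hj
    rw [Finset.mem_range] at hj
    rcases Nat.eq_zero_or_pos j with rfl | hj1
    · have hb := hgb 0 hj
      rw [hz] at hb ⊢
      have hT := ce_node_nonneg n q (0 + 1)
      have hG : 0 ≤ N * q * (((0 + 1 : ℕ) : ℝ) / n) ^ 3 / n := by positivity
      have h1 := ceK_first hc0 hc1 hx0 hT hG hb
      have h2 := ceK_first hc0 hc1 hx0' hT hG hb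
      have h3 := abs_sub (∫ y in (0:ℝ)..(gradedNode n q (0 + 1)), ceK c x y * g y)
        (∫ y in (0:ℝ)..(gradedNode n q (0 + 1)), ceK c x' y * g y)
      refine h3.trans ((add_le_add h1 h2).trans ?_)
      have h4 : L * (N * q * (((0 + 1 : ℕ) : ℝ) / n) ^ 3 / n) = L * q * N / n ^ 4 := by
        push_cast; field_simp
      rw [h4]
      have h5 : 0 ≤ K * q ^ 4 * (2 ^ q) ^ 3 * N / n ^ 4 := by positivity
      have h6 : (2 * L * q + K * q ^ 4 * (2 ^ q) ^ 3) * N / n ^ 4 =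
        L * q * N / n ^ 4 + L * q * N / n ^ 4 + K * q ^ 4 * (2 ^ q) ^ 3 * N / n ^ 4 := by ring
      linarith
    · have hle : gradedNode n q j ≤ gradedNode n q (j + 1) := hm.monotone (by omega)
      have hpos : 0 < gradedNode n q j := by rw [← hz]; exact hm hj1
      set T := gradedNode n q (j + 1) with hT
      have e : (∫ y in (gradedNode n q j)..T, ceK c x y * g y) -
          ∫ y in (gradedNode n q j)..T, ceK c x' y * g y =
          ∫ y in (gradedNode n q j)..T, ((ceK c x y - ceK c x' y) - (ceK c x T - ceK c x' T)) * g y := by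
        rw [← intervalIntegral.integral_sub (hkI x hx0 j hj) (hkI x' hx0' j hj)]
        have e2 : ∀ y, ((ceK c x y - ceK c x' y) - (ceK c x T - ceK c x' T)) * g y =
          (ceK c x y * g y - ceK c x' y * g y) - (ceK c x T - ceK c x' T) * g y := by
            intro y; ring
        simp_rw [e2]
        rw [intervalIntegral.integral_sub ((hkI x hx0 j hj).sub (hkI x' hx0' j hj))
          ((hgI j hj).const_mul _), intervalIntegral.integral_const_mul, hg0 j hj]
        simp
      rw [e]
      have hb := intervalIntegral.norm_integral_le_of_norm_le_const (a := gradedNode n q j) (b := T)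
        (f := fun y => ((ceK c x y - ceK c x' y) - (ceK c x T - ceK c x' T)) * g y)
        (C := (K / (gradedNode n q i + gradedNode n q j) ^ 3 *
          (gradedNode n q (i + 1) - gradedNode n q i) *
          (T - gradedNode n q j)) * (N * q * (((j + 1 : ℕ) : ℝ) / n) ^ 3 / n)) ?_
      · rw [Real.norm_eq_abs, abs_of_nonneg (sub_nonneg.2 hle)] at hb
        refine hb.trans ((ce_term hn hq hN hK0.le hi hj hj1).trans ?_)
        have : 0 ≤ 2 * L * q := by positivity
        gcongr
        linarith
      · intro y hy
        rw [Set.uIoc_of_le hle] at hy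
        rw [norm_mul, Real.norm_eq_abs, Real.norm_eq_abs]
        have h1 := hgb j hj y hy
        have h2 := ce_mixed hc0 hc1 (ce_node_nonneg n q i) hpos hx.1.le hx'.1.le hy.1.le hle
        have h3 : |x - x'| ≤ gradedNode n q (i + 1) - gradedNode n q i := by
          rw [abs_le]; constructor <;> linarith [hx.1, hx.2, hx'.1, hx'.2]
        have h4 : |y - T| ≤ T - gradedNode n q j := by
          rw [abs_le]; constructor <;> linarith [hy.1, hy.2]
        have h5 : 0 < gradedNode n q i + gradedNode n q j := by
          linarith [ce_node_nonneg n q i]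
        apply mul_le_mul _ h1 (abs_nonneg _)
        · have := sub_nonneg.2 hle
          have := (abs_nonneg _).trans h3
          positivity
        · refine h2.trans ?_
          have := (abs_nonneg _).trans h3
          gcongr
  calc _ ≤ _ := Finset.abs_sum_le_sum_abs _ _
    _ ≤ _ := Finset.sum_le_sum hterm
    _ = _ := by
      rw [Finset.sum_const, Finset.card_range, nsmul_eq_mul]
      field_simp

theorem ce_proj_integrable (n : ℕ) (q : ℝ) (u : ℝ → ℝ) :
    Integrable (gradedProj n q u) := by
  unfold gradedProj
  apply integrable_finsetSum
  intro i _
  rw [integrable_indicator_iff measurableSet_Ioc]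
  exact integrableOn_const (by simp)

theorem ce_kernel_eq (p x y : ℝ) :
    cornerKernel p x y = Real.sin (p * Real.pi) / Real.pi * ceK (Real.cos (p * Real.pi)) x y := by
  unfold cornerKernel ceK
  rw [mul_div_assoc]

theorem ce_err_eq (p q : ℝ) (n : ℕ) (u : ℝ → ℝ) (x : ℝ) :
    cornerErr p q n u x = Real.sin (p * Real.pi) / Real.pi *
      ∫ y in (0:ℝ)..1, ceK (Real.cos (p * Real.pi)) x y * (u y - gradedProj n q u y) := by
  unfold cornerErr cornerOp
  rw [intervalIntegral.integral_of_le zero_le_one, ← integral_const_mul]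
  simp_rw [ce_kernel_eq, mul_assoc]

theorem ce_err_meas (p q : ℝ) (n : ℕ) (u : ℝ → ℝ)
    (hg : IntegrableOn (fun y => u y - gradedProj n q u y) (Set.Ioc 0 1)) (s : Set ℝ) :
    AEStronglyMeasurable (cornerErr p q n u) (volume.restrict s) := by
  unfold cornerErr cornerOp
  have hk : Measurable (fun z : ℝ × ℝ => cornerKernel p z.1 z.2) := by
    unfold cornerKernel; fun_prop
  have := (hk.aestronglyMeasurable (μ := (volume.restrict s).prod
    (volume.restrict (Set.Ioc (0:ℝ) 1)))).mul
    (hg.aestronglyMeasurable.comp_snd (μ := volume.restrict s))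
  exact this.integral_prod_right'

/-- Uniform `O(h³)` discrepancy bound for the modified projection method: for
`p ∈ (0,1)`, `0 < α < 1/(1+p)` and grading exponent `q > 4/α`, there is a constant
`C > 0`, independent of `n` and `u`, such that for every `u ∈ C⁴_α`,
`sup_{x∈(0,1]} |((I − π_h)K(I − π_h)u)(x)| ≤ C·n⁻³·‖u‖_{4,α}`. -/
theorem projErr_cornerErr_uniform_bound (p α q : ℝ)
    (hp0 : 0 < p) (hp1 : p < 1) (hα0 : 0 < α) (hα1 : α < 1 / (1 + p))
    (hq : q > 4 / α) :
    ∃ C : ℝ, 0 < C ∧ ∀ n : ℕ, 1 ≤ n → ∀ u : ℝ → ℝ,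
      ContDiffOn ℝ 4 u (Set.Ioc 0 1) → BddAbove (weightedSet 4 α u) →
      ∀ x ∈ Set.Ioc (0 : ℝ) 1,
        |cornerErr p q n u x - gradedProj n q (cornerErr p q n u) x| ≤
          C * ((n : ℝ) ^ 3)⁻¹ * weightedNorm 4 α u := by
  have hp1' : 1 / (1 + p) < 1 := by rw [div_lt_one (by linarith)]; linarith
  have hαlt : α < 1 := hα1.trans hp1'
  have hqα : 4 < q * α := by rwa [gt_iff_lt, div_lt_iff₀ hα0] at hq
  have hq1 : 1 ≤ q := by nlinarith
  have hq0 : 0 < q := by linarith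
  set c := Real.cos (p * Real.pi) with hc
  have hc1 : c ≤ 1 := Real.cos_le_one _
  have hc0 : -1 < c := by
    rw [hc, ← Real.cos_pi]
    apply Real.cos_lt_cos_of_nonneg_of_le_pi <;> nlinarith [Real.pi_pos]
  have hcp : 0 < 1 + c := by linarith
  set C₀ := 2 * ((1 + c) / 2)⁻¹ * q +
        (4 / ((1 + c) / 2) ^ 2 + 8 / ((1 + c) / 2) ^ 3) * q ^ 4 * (2 ^ q) ^ 3 with hC₀
  have hC₀0 : 0 < C₀ := by positivity
  set σ := Real.sin (p * Real.pi) / Real.pi with hσ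
  refine ⟨(|σ| + 1) * C₀, by positivity, ?_⟩
  intro n hn u hu hbdd x hx
  have hn0 : (0 : ℝ) < n := by positivity
  set N := weightedNorm 4 α u with hNdef
  have hval : ∀ i : ℕ, i ≤ 4 → ∀ t ∈ Set.Ioc (0:ℝ) 1,
      t ^ max ((i : ℝ) - α) 0 * |iteratedDerivWithin i u (Set.Ioc 0 1) t| ≤ N :=
    fun i hi t ht => le_csSup hbdd ⟨i, hi, t, ht, rfl⟩
  have hub : ∀ t ∈ Set.Ioc (0:ℝ) 1, |u t| ≤ N := by
    intro t ht
    have := hval 0 (by norm_num) t ht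
    rw [max_eq_right (by simp; linarith)] at this
    simpa using this
  have hN : 0 ≤ N := (abs_nonneg _).trans (hub 1 (by simp))
  have hdb : ∀ t ∈ Set.Ioc (0:ℝ) 1, |derivWithin u (Set.Ioc 0 1) t| ≤ N * t ^ (α - 1) := by
    intro t ht
    have := hval 1 (by norm_num) t ht
    rw [max_eq_left (by simp; linarith), iteratedDerivWithin_one] at this
    have ht0 : 0 < t ^ (1 - α) := Real.rpow_pos_of_pos ht.1 _
    have e : t ^ (α - 1) = (t ^ (1 - α))⁻¹ := by
      rw [← Real.rpow_neg ht.1.le]; ring_nf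
    rw [e, ← div_eq_mul_inv, le_div_iff₀ ht0]
    push_cast at this
    linarith
  have hudiff : DifferentiableOn ℝ u (Set.Ioc 0 1) := hu.differentiableOn (by norm_num)
  have hosc : ∀ a ∈ Set.Ioc (0:ℝ) 1, ∀ b ∈ Set.Ioc (0:ℝ) 1,
      |u b - u a| ≤ N / α * |b ^ α - a ^ α| := by
    intro a ha b hb
    have hNα : 0 ≤ N / α := by positivity
    rcases le_total a b with h | h
    · exact (ce_osc hα0 hudiff hdb ha.1 h hb.2).trans
        (mul_le_mul_of_nonneg_left (le_abs_self _) hNα)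
    · rw [abs_sub_comm, abs_sub_comm (b ^ α)]
      exact (ce_osc hα0 hudiff hdb hb.1 h ha.2).trans
        (mul_le_mul_of_nonneg_left (le_abs_self _) hNα)
  have hui : IntegrableOn u (Set.Ioc 0 1) := by
    refine IntegrableOn.of_bound (by simp) ?_ N ?_
    · exact hudiff.continuousOn.aestronglyMeasurable measurableSet_Ioc
    · exact (ae_restrict_iff' measurableSet_Ioc).2 (Filter.Eventually.of_forall hub)
  have hgi : IntegrableOn (fun y => u y - gradedProj n q u y) (Set.Ioc 0 1) :=
    hui.sub (ce_proj_integrable n q u).integrableOn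
  have hm := ce_node_mono hn hq0
  have hcell : ∀ j < n, Set.Ioc (gradedNode n q j) (gradedNode n q (j + 1)) ⊆ Set.Ioc 0 1 := by
    intro j hj
    apply Set.Ioc_subset_Ioc (ce_node_nonneg n q j)
    rw [← ce_node_n (q := q) hn]
    exact hm.monotone (by omega)
  have hg0 : ∀ j < n, ∫ y in (gradedNode n q j)..(gradedNode n q (j + 1)),
      (u y - gradedProj n q u y) = 0 := by
    intro j hj
    have hlt : gradedNode n q j < gradedNode n q (j + 1) := hm (by omega)
    rw [intervalIntegral.integral_of_le hlt.le,
      setIntegral_congr_fun measurableSet_Ioc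
        (fun y hy => by rw [ce_proj_eq hn hq0 u hj hy]),
      integral_sub (hui.mono_set (hcell j hj)) (integrableOn_const (by simp))]
    have : gradedNode n q (j + 1) - gradedNode n q j ≠ 0 := (sub_pos.2 hlt).ne'
    simp [hlt.le]
    field_simp
    simp
  have hgb : ∀ j < n, ∀ y ∈ Set.Ioc (gradedNode n q j) (gradedNode n q (j + 1)),
      |u y - gradedProj n q u y| ≤ N * q * (((j + 1 : ℕ) : ℝ) / n) ^ 3 / n := by
    intro j hj y hy
    have hlt : gradedNode n q j < gradedNode n q (j + 1) := hm (by omega)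
    rw [ce_proj_eq hn hq0 u hj hy]
    refine ce_mean hlt (hui.mono_set (hcell j hj)) ?_
    intro z hz
    refine (hosc z (hcell j hj hz) y (hcell j hj hy)).trans ?_
    have hnn := ce_node_nonneg n q j
    have hb1 : |y ^ α - z ^ α| ≤ gradedNode n q (j + 1) ^ α - gradedNode n q j ^ α := by
      have y1 := Real.rpow_le_rpow hnn hy.1.le hα0.le
      have y2 := Real.rpow_le_rpow (hnn.trans hy.1.le) hy.2 hα0.le
      have z1 := Real.rpow_le_rpow hnn hz.1.le hα0.le
      have z2 := Real.rpow_le_rpow (hnn.trans hz.1.le) hz.2 hα0.le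
      rw [abs_le]; constructor <;> linarith
    have hb2 := ce_pow_diff (r := q * α) (by linarith) n hn j
    have hb3 : gradedNode n q (j + 1) ^ α - gradedNode n q j ^ α ≤
        q * α * (((j + 1 : ℕ) : ℝ) / n) ^ (q * α - 1) / n := by
      unfold gradedNode
      rw [← Real.rpow_mul (by positivity), ← Real.rpow_mul (by positivity)]
      exact hb2
    have hρ1 : ((j + 1 : ℕ) : ℝ) / n ≤ 1 := by
      rw [div_le_one hn0]; exact_mod_cast hj
    have hb4 : (((j + 1 : ℕ) : ℝ) / n) ^ (q * α - 1) ≤ (((j + 1 : ℕ) : ℝ) / n) ^ 3 := by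
      rw [← Real.rpow_natCast (_ / _) 3]
      apply Real.rpow_le_rpow_of_exponent_ge (by positivity) hρ1
      push_cast; linarith
    calc _ ≤ N / α * (q * α * (((j + 1 : ℕ) : ℝ) / n) ^ 3 / n) := by
          apply mul_le_mul_of_nonneg_left _ (by positivity)
          refine hb1.trans (hb3.trans ?_)
          gcongr
      _ = _ := by field_simp
  obtain ⟨i, hi, hxi⟩ := ce_exists_cell hn hq0 hx
  have hosc2 : ∀ y ∈ Set.Ioc (gradedNode n q i) (gradedNode n q (i + 1)),
      |cornerErr p q n u x - cornerErr p q n u y| ≤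
        (|σ| + 1) * C₀ * ((n : ℝ) ^ 3)⁻¹ * N := by
    intro y hy
    rw [ce_err_eq, ce_err_eq, ← mul_sub, abs_mul]
    have := ce_diff hc0 hc1 hn hq1 hN hi hgi hg0 hgb hxi hy
    calc _ ≤ |σ| * (C₀ * ((n : ℝ) ^ 3)⁻¹ * N) := mul_le_mul_of_nonneg_left this (abs_nonneg _)
      _ ≤ (|σ| + 1) * (C₀ * ((n : ℝ) ^ 3)⁻¹ * N) := by
          apply mul_le_mul_of_nonneg_right (by linarith) (by positivity)
      _ = _ := by ring
  have hlt : gradedNode n q i < gradedNode n q (i + 1) := hm (by omega)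
  rw [ce_proj_eq hn hq0 _ hi hxi]
  refine ce_mean hlt ?_ hosc2
  refine IntegrableOn.of_bound (by simp) ?_
    (|cornerErr p q n u x| + (|σ| + 1) * C₀ * ((n : ℝ) ^ 3)⁻¹ * N) ?_
  · exact ce_err_meas p q n u hgi _
  · refine (ae_restrict_iff' measurableSet_Ioc).2 (Filter.Eventually.of_forall fun y hy => ?_)
    have h1 := hosc2 y hy
    have h2 := abs_sub_abs_le_abs_sub (cornerErr p q n u y) (cornerErr p q n u x)
    rw [abs_sub_comm] at h2
    rw [Real.norm_eq_abs]
    linarith
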